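/- arXiv:1509.07095 — 6 statements merged into one kernel-verified Lean document; each statement's English description precedes it below -/
import Mathlib

section
/- Let $Q$ be a field of characteristic zero, let $F_0/Q$ be a finite algebraic field extension, and let $F/F_0$ be a quadratic field extension with $\tau \in \mathrm{Gal}(F/F_0)$ the unique nontrivial element (an involution). Then there exists $u \in F$ such that $Q(u) = F$ (equivalently, the $Q$-subalgebra of $F$ generated by $u$ is all of $F$) and $u\cdot \tau(u) = 1$. -/
/-- An intermediate field of `F / Q` containing the image of `F₀`, where `F / F₀` is quadratic, and
an element outside that image is everything. -/
theorem IntermediateField.eq_top_of_finrank_eq_two {Q F₀ F : Type*} [Field Q] [Field F₀] [Field F]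
    [Algebra F₀ F] [Algebra Q F] (h2 : Module.finrank F₀ F = 2) (E : IntermediateField Q F)
    (hE : ∀ x : F₀, algebraMap F₀ F x ∈ E) {s : F} (hs : s ∈ E)
    (hs' : ∀ x : F₀, algebraMap F₀ F x ≠ s) : E = ⊤ := by
  let K : IntermediateField F₀ F := E.toSubfield.toIntermediateField hE
  have hsimple : IsSimpleOrder (IntermediateField F₀ F) :=
    IntermediateField.isSimpleOrder_of_finrank_prime F₀ F (h2 ▸ Nat.prime_two)
  have hsK : s ∈ K := hs
  rcases hsimple.eq_bot_or_eq_top K with hK | hK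
  · rw [hK, IntermediateField.mem_bot] at hsK
    obtain ⟨x, hx⟩ := hsK
    exact absurd hx (hs' x)
  · refine top_unique fun x _ => ?_
    have hx : x ∈ K := hK ▸ IntermediateField.mem_top
    exact hx

/-- The nontrivial automorphism of a separable quadratic extension is an involution. -/
theorem AlgEquiv.apply_apply_of_finrank_eq_two {K L : Type*} [Field K] [Field L] [CharZero K]
    [Algebra K L] (h2 : Module.finrank K L = 2) (τ : L ≃ₐ[K] L) (x : L) : τ (τ x) = x := by
  have : Algebra.IsQuadraticExtension K L := { finrank_eq_two' := h2 }
  have hcard := IsGalois.card_aut_eq_finrank K L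
  have hτ : τ ^ 2 = 1 := by
    rw [← h2, ← hcard]
    exact pow_card_eq_one'
  simpa [pow_two] using DFunLike.congr_fun hτ x

/-- A quadratic extension `F / F₀` is generated over `Q` by a single anti-invariant element. -/
theorem exists_adjoin_eq_top_of_apply_eq_neg (Q F₀ F : Type*) [Field Q] [Field F₀] [Field F]
    [CharZero Q] [Algebra Q F₀] [Algebra F₀ F] [Algebra Q F] [IsScalarTower Q F₀ F]
    [FiniteDimensional Q F₀] (h2 : Module.finrank F₀ F = 2)
    (τ : F ≃ₐ[F₀] F) (hτ : τ ≠ AlgEquiv.refl) :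
    ∃ t : F, IntermediateField.adjoin Q {t} = ⊤ ∧ τ t = -t := by
  have : CharZero F₀ := charZero_of_injective_algebraMap (algebraMap Q F₀).injective
  have : CharZero F := charZero_of_injective_algebraMap (algebraMap Q F).injective
  have : FiniteDimensional F₀ F := Module.finite_of_finrank_eq_succ h2
  have : FiniteDimensional Q F := FiniteDimensional.trans Q F₀ F
  obtain ⟨y, hy⟩ : ∃ y, τ y ≠ y := by
    by_contra! h
    exact hτ (AlgEquiv.ext h)
  obtain ⟨s, hs0, hs⟩ : ∃ s : F, s ≠ 0 ∧ τ s = -s :=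
    ⟨y - τ y, sub_ne_zero.mpr hy.symm, by
      rw [map_sub, τ.apply_apply_of_finrank_eq_two h2, neg_sub]⟩
  obtain ⟨α, hα⟩ := Field.exists_primitive_element Q F₀
  have : Finite (IntermediateField Q F) :=
    Field.finite_intermediateField_of_exists_primitive_element Q F
      (Field.exists_primitive_element Q F)
  obtain ⟨p, q, hpq, h⟩ := Finite.exists_ne_map_eq_of_infinite fun q : Q =>
    IntermediateField.adjoin Q {algebraMap F₀ F (α + algebraMap Q F₀ q) * s}
  refine ⟨algebraMap F₀ F (α + algebraMap Q F₀ p) * s, ?_, by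
    rw [map_mul, τ.commutes, hs, mul_neg]⟩
  set E := IntermediateField.adjoin Q {algebraMap F₀ F (α + algebraMap Q F₀ p) * s}
  have hp : algebraMap F₀ F (α + algebraMap Q F₀ p) * s ∈ E :=
    IntermediateField.mem_adjoin_simple_self Q _
  have hq : algebraMap F₀ F (α + algebraMap Q F₀ q) * s ∈ E := by
    rw [h]
    exact IntermediateField.mem_adjoin_simple_self Q _
  simp only [map_add, ← IsScalarTower.algebraMap_apply] at hp hq
  have hpq' : algebraMap Q F p - algebraMap Q F q ≠ 0 :=
    sub_ne_zero.mpr fun h => hpq ((algebraMap Q F).injective h)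
  have hsE : s ∈ E := by
    have := E.div_mem (E.sub_mem hp hq)
      (E.sub_mem (E.algebraMap_mem p) (E.algebraMap_mem q))
    convert this using 1
    field_simp
    ring
  have hαE : algebraMap F₀ F α ∈ E := by
    have := E.sub_mem (E.div_mem hp hsE) (E.algebraMap_mem p)
    convert this using 1
    field_simp
    ring
  refine E.eq_top_of_finrank_eq_two h2 (fun x => ?_) hsE fun x hx => ?_
  · have hle : IntermediateField.adjoin Q {α} ≤ E.comap (IsScalarTower.toAlgHom Q F₀ F) := by
      rw [IntermediateField.adjoin_simple_le_iff]
      exact hαE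
    have hx : x ∈ IntermediateField.adjoin Q {α} := hα ▸ IntermediateField.mem_top
    exact hle hx
  · rw [← hx, τ.commutes, hx] at hs
    exact hs0 (self_eq_neg.mp hs)


/-- Zarhin, Lemma on quadratic extensions.
Let `Q` be a field of characteristic zero, `F₀/Q` a finite algebraic field extension and
`F/F₀` a quadratic field extension, with `τ` the unique nontrivial element of `Gal(F/F₀)`.
Then there exists `u ∈ F` such that the `Q`-subalgebra (equivalently, subfield) generated by
`u` is all of `F` and `u * τ u = 1`. -/
theorem statement0
    (Q F₀ F : Type*) [Field Q] [Field F₀] [Field F] [CharZero Q]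
    [Algebra Q F₀] [Algebra F₀ F] [Algebra Q F] [IsScalarTower Q F₀ F]
    [FiniteDimensional Q F₀]
    (h2 : Module.finrank F₀ F = 2)
    (τ : F ≃ₐ[F₀] F) (hτ : τ ≠ AlgEquiv.refl) :
    ∃ u : F, Algebra.adjoin Q {u} = ⊤ ∧ u * τ u = 1 := by
  have : CharZero F := charZero_of_injective_algebraMap (algebraMap Q F).injective
  have : FiniteDimensional F₀ F := Module.finite_of_finrank_eq_succ h2
  have : FiniteDimensional Q F := FiniteDimensional.trans Q F₀ F
  obtain ⟨t, ht, hτt⟩ := exists_adjoin_eq_top_of_apply_eq_neg Q F₀ F h2 τ hτ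
  have hsub : 1 - t ≠ 0 := fun h => by
    rw [← sub_eq_zero.mp h, map_one] at hτt
    exact one_ne_zero (self_eq_neg.mp hτt)
  have hadd : 1 + t ≠ 0 := fun h => by
    rw [eq_neg_of_add_eq_zero_right h, map_neg, map_one, neg_neg] at hτt
    exact one_ne_zero (self_eq_neg.mp hτt.symm)
  refine ⟨(1 + t) / (1 - t), ?_, ?_⟩
  · set u := (1 + t) / (1 - t) with hu
    have hu1 : u + 1 = 2 / (1 - t) := by
      rw [hu]
      field_simp
      ring
    have htu : t = (u - 1) / (u + 1) := by
      rw [hu1, hu]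
      field_simp
      ring
    have huE : u ∈ IntermediateField.adjoin Q {u} :=
      IntermediateField.mem_adjoin_simple_self Q u
    have htop : IntermediateField.adjoin Q {u} = ⊤ := by
      rw [eq_top_iff, ← ht, IntermediateField.adjoin_simple_le_iff, htu]
      exact div_mem (sub_mem huE (one_mem _)) (add_mem huE (one_mem _))
    rw [← IntermediateField.adjoin_simple_toSubalgebra_of_isAlgebraic
      (Algebra.IsAlgebraic.isAlgebraic u), htop, IntermediateField.top_toSubalgebra]
  · rw [map_div₀, map_add, map_sub, map_one, hτt, sub_neg_eq_add, ← sub_eq_add_neg]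
    field_simp
end

section
/- Let $Q$ be a field of characteristic zero, let $F_0/Q$ be a finite algebraic field extension, and let $\delta$ be a nonzero element of $F_0$. Then there exists a nonzero $\beta_0 \in F_0$ such that $Q(\delta\beta_0^2) = F_0$ and $\delta\beta_0^2 + 1 \neq 0$. -/
/-- An intermediate field containing `δ * (θ + n) ^ 2` for three distinct natural numbers `n`
contains `θ`. -/
theorem IntermediateField.mem_of_three_mul_add_sq_mem {Q F₀ : Type*} [Field Q] [Field F₀]
    [CharZero F₀] [Algebra Q F₀] {K : IntermediateField Q F₀} {δ θ : F₀} (hδ : δ ≠ 0)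
    {a b c : ℕ} (hab : a ≠ b) (hac : a ≠ c) (hbc : b ≠ c)
    (ha : δ * (θ + a) ^ 2 ∈ K) (hb : δ * (θ + b) ^ 2 ∈ K) (hc : δ * (θ + c) ^ 2 ∈ K) :
    θ ∈ K := by
  have hab' : (a : F₀) - b ≠ 0 := sub_ne_zero.mpr (Nat.cast_injective.ne hab)
  have hac' : (a : F₀) - c ≠ 0 := sub_ne_zero.mpr (Nat.cast_injective.ne hac)
  have hbc' : (b : F₀) - c ≠ 0 := sub_ne_zero.mpr (Nat.cast_injective.ne hbc)
  have hN (n : ℕ) : (n : F₀) ∈ K := natCast_mem K n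
  have hu : δ * (2 * θ + a + b) ∈ K := by
    convert K.div_mem (K.sub_mem ha hb) (K.sub_mem (hN a) (hN b)) using 1
    field_simp
    ring
  have hv : δ * (2 * θ + a + c) ∈ K := by
    convert K.div_mem (K.sub_mem ha hc) (K.sub_mem (hN a) (hN c)) using 1
    field_simp
    ring
  have hδK : δ ∈ K := by
    convert K.div_mem (K.sub_mem hu hv) (K.sub_mem (hN b) (hN c)) using 1
    field_simp
    ring
  convert K.div_mem (K.sub_mem (K.sub_mem (K.div_mem hu hδK) (hN a)) (hN b)) (hN 2) using 1
  field_simp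
  push_cast
  ring

open IntermediateField Polynomial in
/-- Let `Q` be a field of characteristic zero, `F₀/Q` a finite algebraic
field extension and `δ` a nonzero element of `F₀`. Then there exists a nonzero `β₀ ∈ F₀`
such that `Q(δ·β₀²) = F₀` and `δ·β₀² + 1 ≠ 0`. -/
theorem statement1
    (Q F₀ : Type*) [Field Q] [Field F₀] [CharZero Q]
    [Algebra Q F₀] [FiniteDimensional Q F₀]
    (δ : F₀) (hδ : δ ≠ 0) :
    ∃ β₀ : F₀, β₀ ≠ 0 ∧ Algebra.adjoin Q {δ * β₀ ^ 2} = ⊤ ∧ δ * β₀ ^ 2 + 1 ≠ 0 := by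
  have : CharZero F₀ := charZero_of_injective_algebraMap (algebraMap Q F₀).injective
  obtain ⟨θ, hθ⟩ := Field.exists_primitive_element Q F₀
  have : Finite (IntermediateField Q F₀) :=
    Field.finite_intermediateField_of_exists_primitive_element Q F₀ ⟨θ, hθ⟩
  obtain ⟨K, hK⟩ := Finite.exists_infinite_fiber fun n : ℕ ↦ Q⟮δ * (θ + n) ^ 2⟯
  rw [Set.infinite_coe_iff] at hK
  have hmem {n : ℕ} (hn : n ∈ (fun n : ℕ ↦ Q⟮δ * (θ + n) ^ 2⟯) ⁻¹' {K}) :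
      δ * (θ + n) ^ 2 ∈ K := by
    rw [← show Q⟮δ * (θ + n) ^ 2⟯ = K from hn]
    exact mem_adjoin_simple_self Q _
  have hKtop : K = ⊤ := by
    obtain ⟨t, ht, htc⟩ := hK.exists_subset_card_eq 3
    obtain ⟨a, b, c, hab, hac, hbc, rfl⟩ := Finset.card_eq_three.mp htc
    rw [← top_le_iff, ← hθ, adjoin_simple_le_iff]
    exact mem_of_three_mul_add_sq_mem hδ hab hac hbc
      (hmem (ht (by simp))) (hmem (ht (by simp))) (hmem (ht (by simp)))
  have hp : (X * (C δ * X ^ 2 + 1) : F₀[X]) ≠ 0 := by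
    refine mul_ne_zero X_ne_zero fun h ↦ ?_
    simpa using congrArg (eval 0) h
  have hinj : Function.Injective fun n : ℕ ↦ θ + (n : F₀) :=
    (add_right_injective θ).comp Nat.cast_injective
  obtain ⟨n, hn, hroot⟩ := hK.exists_notMem_finite
    ((finite_setOfPred_isRoot hp).preimage hinj.injOn)
  simp only [Set.mem_preimage, Set.mem_ofPred_eq, IsRoot.def, eval_mul, eval_add, eval_pow,
    eval_X, eval_C, eval_one, mul_eq_zero, not_or] at hroot
  refine ⟨θ + n, hroot.1, ?_, hroot.2⟩
  rw [← adjoin_simple_toSubalgebra_of_isAlgebraic (Algebra.IsAlgebraic.isAlgebraic _),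
    show Q⟮δ * (θ + n) ^ 2⟯ = K from hn, hKtop, top_toSubalgebra]
end

section
/- Let $p$ be a prime, $F_0$ a finite field extension of $\mathbb{Q}_p$, and $C$ a 2-dimensional commutative semisimple $F_0$-algebra (so $C$ is either a quadratic field extension of $F_0$ or is isomorphic as an $F_0$-algebra to $F_0 \oplus F_0$). Then there exists $\mathbf{u} \in C^\times$ such that the norm $N_{C/F_0}(\mathbf{u}) = 1$ (i.e., the determinant of the $F_0$-linear operator 'multiplication by $\mathbf{u}$' on $C$ equals 1) and the $\mathbb{Q}_p$-subalgebra of $C$ generated by $\mathbf{u}$ equals $C$. -/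
/-- A subalgebra of a finite-dimensional commutative algebra is closed under inverses. -/
theorem Subalgebra.mem_of_mul_eq_one_of_finiteDimensional {K C : Type*} [Field K] [CommRing C]
    [Algebra K C] [FiniteDimensional K C] (S : Subalgebra K C) {v y : C} (hv : v ∈ S)
    (hvy : v * y = 1) : y ∈ S := by
  have hinj : Function.Injective (LinearMap.mulLeft K (⟨v, hv⟩ : S)) := by
    intro a b hab
    have hab' : v * (a : C) = v * (b : C) := congrArg Subtype.val hab
    apply Subtype.ext
    linear_combination (y : C) * hab' - ((a : C) - b) * hvy
  obtain ⟨s, hs⟩ := LinearMap.surjective_of_injective hinj 1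
  have hs' : v * (s : C) = 1 := congrArg Subtype.val hs
  have hys : y = s := by linear_combination (s : C) * hvy - y * hs'
  exact hys ▸ s.2

/-- If `d ≠ 0` in a finite extension `F` of a field `K` of characteristic zero, then `F` is
generated over `K` by some `t ^ 2 * d` with `t ≠ 0`; moreover `t ^ 2 * d ≠ 1` can be arranged. -/
theorem exists_adjoin_sq_mul_eq_top {K F : Type*} [Field K] [CharZero K] [Field F] [Algebra K F]
    [FiniteDimensional K F] {d : F} (hd : d ≠ 0) :
    ∃ t : F, t ≠ 0 ∧ t ^ 2 * d ≠ 1 ∧ Algebra.adjoin K {t ^ 2 * d} = ⊤ := by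
  classical
  obtain ⟨α, hα⟩ := Field.exists_primitive_element K F
  have : Finite (IntermediateField K F) :=
    Field.finite_intermediateField_of_exists_primitive_element K F ⟨α, hα⟩
  obtain ⟨L, hL⟩ := Finite.exists_infinite_fiber
    fun c : K ↦ IntermediateField.adjoin K {(α + algebraMap K F c) ^ 2 * d}
  let A : Set K :=
    (fun c : K ↦ IntermediateField.adjoin K {(α + algebraMap K F c) ^ 2 * d}) ⁻¹' {L}
  have hA : A.Infinite := Set.infinite_coe_iff.mp hL
  have hmem : ∀ c ∈ A, (α + algebraMap K F c) ^ 2 * d ∈ L := fun c hc ↦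
    (show IntermediateField.adjoin K {(α + algebraMap K F c) ^ 2 * d} = L from hc) ▸
      IntermediateField.mem_adjoin_simple_self K _
  obtain ⟨a, ha⟩ := hA.nonempty
  obtain ⟨b, hb, hba⟩ := hA.exists_notMem_finset {a}
  obtain ⟨c, hc, hcab⟩ := hA.exists_notMem_finset {a, b}
  simp only [Finset.mem_insert, Finset.mem_singleton, not_or] at hba hcab
  have hL_top : L = ⊤ := by
    have hba' : algebraMap K F b - algebraMap K F a ≠ 0 := by
      simpa [sub_eq_zero] using hba
    have hca' : algebraMap K F c - algebraMap K F a ≠ 0 := by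
      simpa [sub_eq_zero] using hcab.1
    have hcb' : algebraMap K F c - algebraMap K F b ≠ 0 := by
      simpa [sub_eq_zero] using hcab.2
    have ma := L.algebraMap_mem a
    have mb := L.algebraMap_mem b
    have mc := L.algebraMap_mem c
    have pa := hmem a ha
    have pb := hmem b hb
    have pc := hmem c hc
    generalize algebraMap K F a = a at *
    generalize algebraMap K F b = b at *
    generalize algebraMap K F c = c at *
    have qb : (2 * α + b + a) * d ∈ L := by
      have : (2 * α + b + a) * d = ((α + b) ^ 2 * d - (α + a) ^ 2 * d) / (b - a) := by
        field_simp; ring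
      exact this ▸ div_mem (sub_mem pb pa) (sub_mem mb ma)
    have qc : (2 * α + c + a) * d ∈ L := by
      have : (2 * α + c + a) * d = ((α + c) ^ 2 * d - (α + a) ^ 2 * d) / (c - a) := by
        field_simp; ring
      exact this ▸ div_mem (sub_mem pc pa) (sub_mem mc ma)
    have md : d ∈ L := by
      have : d = ((2 * α + c + a) * d - (2 * α + b + a) * d) / (c - b) := by
        field_simp; ring
      rw [this]
      exact div_mem (sub_mem qc qb) (sub_mem mc mb)
    have : CharZero F := charZero_of_injective_algebraMap (algebraMap K F).injective
    have mα : α ∈ L := by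
      have : α = ((2 * α + b + a) * d / d - b - a) / 2 := by
        field_simp; ring
      rw [this]
      exact div_mem (sub_mem (sub_mem (div_mem qb md) mb) ma) (ofNat_mem L 2)
    rw [← top_le_iff, ← hα]
    exact IntermediateField.adjoin_simple_le_iff.mpr mα
  have hroots : {x : F | x = 0 ∨ x ^ 2 * d = 1}.Finite := by
    let P : Polynomial F := Polynomial.X * (Polynomial.C d * Polynomial.X ^ 2 - 1)
    have hP : P ≠ 0 := by
      refine mul_ne_zero Polynomial.X_ne_zero fun h ↦ ?_
      simpa using congrArg (Polynomial.eval 0) h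
    refine (P.roots.toFinset.finite_toSet).subset fun x hx ↦ ?_
    rw [Finset.mem_coe, Multiset.mem_toFinset, Polynomial.mem_roots hP]
    simpa [P, sub_eq_zero, mul_comm d] using hx
  have hinj : Function.Injective fun c : K ↦ α + algebraMap K F c := fun x y hxy ↦
    (algebraMap K F).injective (add_left_cancel hxy)
  obtain ⟨e, he, hne⟩ := hA.exists_notMem_finite (hroots.preimage hinj.injOn)
  simp only [Set.mem_preimage, Set.mem_ofPred_eq, not_or] at hne
  refine ⟨α + algebraMap K F e, hne.1, hne.2, ?_⟩
  rw [← IntermediateField.adjoin_simple_toSubalgebra_of_isAlgebraic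
    (Algebra.IsAlgebraic.isAlgebraic (R := K) _)]
  have he' : IntermediateField.adjoin K {(α + algebraMap K F e) ^ 2 * d} = L := he
  rw [he', hL_top, IntermediateField.top_toSubalgebra]

/-- A reduced quadratic algebra over a field in which `2` is invertible has a basis `1, δ` with
`δ ^ 2` a nonzero scalar. -/
theorem exists_basis_one_sq_eq_algebraMap {F C : Type*} [Field F] [NeZero (2 : F)] [CommRing C]
    [Algebra F C] [IsReduced C] (h2 : Module.finrank F C = 2) :
    ∃ (B : Module.Basis (Fin 2) F C) (d : F), B 0 = 1 ∧ d ≠ 0 ∧ B 1 ^ 2 = algebraMap F C d := by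
  have : Nontrivial C := Module.nontrivial_of_finrank_pos (R := F) (by omega)
  have hcard : Fintype.card (Fin 2) = Module.finrank F C := by simp [h2]
  have exists_basis : ∀ x : C, (∀ c : F, c • (1 : C) ≠ x) →
      ∃ B : Module.Basis (Fin 2) F C, B 0 = 1 ∧ B 1 = x := fun x hx ↦
    ⟨basisOfLinearIndependentOfCardEqFinrank
      ((LinearIndependent.pair_iff' one_ne_zero).mpr hx) hcard, by simp, by simp⟩
  obtain ⟨x, hx⟩ : ∃ x : C, ∀ c : F, c • (1 : C) ≠ x := by
    by_contra! h
    have := finrank_le_one (1 : C) h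
    omega
  obtain ⟨B, hB0, hB1⟩ := exists_basis x hx
  have hsq := B.sum_repr (x ^ 2)
  rw [Fin.sum_univ_two, hB0, hB1] at hsq
  generalize B.repr (x ^ 2) 0 = b at hsq
  generalize B.repr (x ^ 2) 1 = a at hsq
  have hδ : ∀ c : F, c • (1 : C) ≠ x - algebraMap F C (a / 2) := fun c hc ↦
    hx (c + a / 2) (by rw [add_smul, hc, Algebra.smul_def (a / 2)]; ring)
  obtain ⟨B', hB'0, hB'1⟩ := exists_basis _ hδ
  have hdsq : (x - algebraMap F C (a / 2)) ^ 2 = algebraMap F C (b + (a / 2) ^ 2) := by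
    have ha : algebraMap F C a = 2 * algebraMap F C (a / 2) := by
      rw [← map_ofNat (algebraMap F C) 2, ← map_mul, mul_div_cancel₀ _ two_ne_zero]
    rw [Algebra.smul_def, Algebra.smul_def, ha] at hsq
    rw [map_add, map_pow]
    linear_combination -hsq
  refine ⟨B', b + (a / 2) ^ 2, hB'0, fun h0 ↦ ?_, by rw [hB'1, hdsq]⟩
  rw [h0, map_zero] at hdsq
  exact hδ 0 (by rw [zero_smul, eq_zero_of_pow_eq_zero hdsq])

/-- The norm form of a quadratic algebra with basis `1, δ`, where `δ ^ 2 = d` is a scalar. -/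
theorem norm_algebraMap_add_smul {F C : Type*} [Field F] [CommRing C] [Algebra F C]
    (B : Module.Basis (Fin 2) F C) {d : F} (h0 : B 0 = 1) (h1 : B 1 ^ 2 = algebraMap F C d)
    (x y : F) : Algebra.norm F (algebraMap F C x + y • B 1) = x ^ 2 - y ^ 2 * d := by
  have e0 : (algebraMap F C x + y • B 1) * B 0 = x • B 0 + y • B 1 := by
    rw [h0, mul_one, Algebra.smul_def x, mul_one]
  have e1 : (algebraMap F C x + y • B 1) * B 1 = (y * d) • B 0 + x • B 1 := by
    simp only [Algebra.smul_def, h0, map_mul]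
    linear_combination algebraMap F C y * h1
  rw [Algebra.norm_eq_matrix_det B, Matrix.det_fin_two]
  simp only [Algebra.leftMulMatrix_eq_repr_mul, e0, e1]
  simp
  ring

/-- A reduced quadratic algebra over a finite extension `F` of a field `K` of characteristic zero
is generated over `K` by a unit whose norm to `F` is `1`. -/
theorem exists_unit_norm_eq_one_adjoin_eq_top {K F C : Type*} [Field K] [CharZero K] [Field F]
    [Algebra K F] [FiniteDimensional K F] [CommRing C] [Algebra F C] [IsReduced C] [Algebra K C]
    [IsScalarTower K F C] (h2 : Module.finrank F C = 2) :
    ∃ u : Cˣ, Algebra.norm F (u : C) = 1 ∧ Algebra.adjoin K {(u : C)} = ⊤ := by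
  have : CharZero F := charZero_of_injective_algebraMap (algebraMap K F).injective
  have : FiniteDimensional F C := Module.finite_of_finrank_pos (by omega)
  have : FiniteDimensional K C := FiniteDimensional.trans K F C
  obtain ⟨B, d, hB0, hd, hB1⟩ := exists_basis_one_sq_eq_algebraMap h2
  obtain ⟨t, ht, hne, htop⟩ := exists_adjoin_sq_mul_eq_top (K := K) hd
  set e := t ^ 2 * d with he
  set w : C := t • B 1 with hw
  have hwsq : w ^ 2 = algebraMap F C e := by
    rw [hw, smul_pow, hB1, Algebra.smul_def, ← map_mul]
  have he1 : 1 - e ≠ 0 := sub_ne_zero.mpr (Ne.symm hne)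
  set r := algebraMap F C (1 - e)⁻¹
  have hr : r * (1 - w ^ 2) = 1 := by
    rw [hwsq, ← map_one (algebraMap F C), ← map_sub, ← map_mul, inv_mul_cancel₀ he1]
  have huinv : (1 + w) ^ 2 * r * ((1 - w) ^ 2 * r) = 1 := by
    linear_combination (r * (1 - w ^ 2) + 1) * hr
  refine ⟨⟨(1 + w) ^ 2 * r, (1 - w) ^ 2 * r, huinv, by rw [mul_comm, huinv]⟩, ?_, ?_⟩
  · have hu : (1 + w) ^ 2 * r =
        algebraMap F C ((1 + e) * (1 - e)⁻¹) + (2 * t * (1 - e)⁻¹) • B 1 := by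
      rw [Algebra.smul_def]
      simp only [map_mul, map_add, map_one, ← hwsq, map_ofNat]
      rw [hw, Algebra.smul_def]
      ring
    change Algebra.norm F ((1 + w) ^ 2 * r) = 1
    rw [hu, norm_algebraMap_add_smul B hB0 hB1]
    field_simp
    rw [he]
    ring
  · change Algebra.adjoin K {(1 + w) ^ 2 * r} = ⊤
    set S := Algebra.adjoin K {(1 + w) ^ 2 * r}
    have hu : (1 + w) ^ 2 * r ∈ S := Algebra.self_mem_adjoin_singleton K _
    have hhalf : algebraMap K C 2⁻¹ * 2 = 1 := by
      rw [← map_ofNat (algebraMap K C) 2, ← map_mul, inv_mul_cancel₀ two_ne_zero, map_one]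
    have hinv : (1 + (1 + w) ^ 2 * r) * (algebraMap K C 2⁻¹ * (1 - w)) = 1 := by
      linear_combination (algebraMap K C 2⁻¹ * (1 + w)) * hr + hhalf
    have hw_half := S.mem_of_mul_eq_one_of_finiteDimensional (S.add_mem S.one_mem hu) hinv
    have hwS : w ∈ S := by
      have : w = 1 - 2 * (algebraMap K C 2⁻¹ * (1 - w)) := by
        linear_combination (1 - w) * hhalf
      rw [this]
      exact S.sub_mem S.one_mem (S.mul_mem (ofNat_mem S 2) hw_half)
    have hF : ∀ x : F, algebraMap F C x ∈ S := by
      have hle : Algebra.adjoin K {e} ≤ S.comap (IsScalarTower.toAlgHom K F C) := by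
        rw [Algebra.adjoin_le_iff, Set.singleton_subset_iff]
        simpa [← hwsq] using S.pow_mem hwS 2
      rw [htop] at hle
      exact fun x ↦ hle (Algebra.mem_top (R := K))
    have hδ : B 1 ∈ S := by
      have : B 1 = algebraMap F C t⁻¹ * w := by
        rw [hw, ← Algebra.smul_def, smul_smul, inv_mul_cancel₀ ht, one_smul]
      exact this ▸ S.mul_mem (hF _) hwS
    refine eq_top_iff.mpr fun z _ ↦ ?_
    rw [← B.sum_repr z, Fin.sum_univ_two, hB0, Algebra.smul_def, Algebra.smul_def]
    exact S.add_mem (S.mul_mem (hF _) S.one_mem) (S.mul_mem (hF _) hδ)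


/-- Let `F₀` be a finite field extension of `ℚ_p` and `C` a
`2`-dimensional commutative semisimple (equivalently, reduced) `F₀`-algebra. Then there
exists `u ∈ C^×` such that `N_{C/F₀}(u) = 1` and the `ℚ_p`-subalgebra of `C` generated by
`u` equals `C`. -/
theorem statement6
    (p : ℕ) [Fact p.Prime]
    (F₀ : Type*) [Field F₀] [Algebra ℚ_[p] F₀] [FiniteDimensional ℚ_[p] F₀]
    (C : Type*) [CommRing C] [Algebra F₀ C] [IsReduced C]
    [Algebra ℚ_[p] C] [IsScalarTower ℚ_[p] F₀ C]
    (h2 : Module.finrank F₀ C = 2) :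
    ∃ u : Cˣ, Algebra.norm F₀ (u : C) = 1 ∧ Algebra.adjoin ℚ_[p] {(u : C)} = ⊤ := by
  exact exists_unit_norm_eq_one_adjoin_eq_top h2
end

section
/- Let $p$ be a prime and $F_0$ a finite extension of $\mathbb{Q}_p$ of degree $g$ with ring of integers $\mathcal{O}_0$. Let $u_1$ be a nonzero element of $p\mathcal{O}_0$ such that the $\mathbb{Q}_p$-subalgebra generated by $u_1$ equals $F_0$. Then the minimal polynomials over $\mathbb{Q}_p$ of $u_1$ and of $u_1^{-1}$ are relatively prime (in particular distinct), and the $\mathbb{Q}_p$-subalgebra of $F_0 \times F_0$ generated by the element $(u_1, u_1^{-1})$ equals all of $F_0 \times F_0$. -/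
open Polynomial in
/-- If two elements have coprime minimal polynomials and each generates its algebra, then the pair
generates the product algebra. -/
theorem Algebra.adjoin_prodMk_eq_top_of_isCoprime_minpoly {K A B : Type*} [Field K]
    [CommRing A] [Algebra K A] [CommRing B] [Algebra K B] {x : A} {y : B}
    (h : IsCoprime (minpoly K x) (minpoly K y))
    (hx : Algebra.adjoin K {x} = ⊤) (hy : Algebra.adjoin K {y} = ⊤) :
    Algebra.adjoin K {(x, y)} = ⊤ := by
  rw [_root_.eq_top_iff]
  rintro ⟨a, b⟩ -
  obtain ⟨f, hf⟩ : ∃ f : K[X], aeval x f = a := by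
    rw [← AlgHom.mem_range, ← Algebra.adjoin_singleton_eq_range_aeval, hx]
    trivial
  obtain ⟨g, hg⟩ : ∃ g : K[X], aeval y g = b := by
    rw [← AlgHom.mem_range, ← Algebra.adjoin_singleton_eq_range_aeval, hy]
    trivial
  obtain ⟨s, t, hst⟩ := h
  have hsx := congrArg (aeval x) hst
  have hsy := congrArg (aeval y) hst
  simp only [map_add, map_mul, minpoly.aeval, mul_zero, zero_add, add_zero, map_one] at hsx hsy
  rw [Algebra.adjoin_singleton_eq_range_aeval, AlgHom.mem_range]
  refine ⟨f * (t * minpoly K y) + g * (s * minpoly K x), ?_⟩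
  rw [aeval_prod_apply]
  simp [hsx, hsy, hf, hg]

/-- If `x` generates a finite field extension as an algebra, then so does `x⁻¹`. -/
theorem Algebra.adjoin_inv_eq_top {K L : Type*} [Field K] [Field L] [Algebra K L]
    [FiniteDimensional K L] {x : L} (hx : Algebra.adjoin K {x} = ⊤) :
    Algebra.adjoin K {x⁻¹} = ⊤ := by
  rw [_root_.eq_top_iff, ← hx, Algebra.adjoin_le_iff, Set.singleton_subset_iff, SetLike.mem_coe]
  have hmem : x⁻¹ ∈ Algebra.adjoin K {x⁻¹} := Algebra.self_mem_adjoin_singleton K _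
  simpa using (Algebra.adjoin K {x⁻¹}).inv_mem_of_algebraic (x := ⟨x⁻¹, hmem⟩)
    (Algebra.IsAlgebraic.isAlgebraic x⁻¹)

open Polynomial in
/-- Integrality of a scalar multiple `c • x` depends only on the minimal polynomial of `x`. -/
theorem IsIntegral.smul_of_minpoly_eq {R K L : Type*} [CommRing R] [Field K] [Algebra R K]
    [CommRing L] [Algebra K L] [Algebra R L] [IsScalarTower R K L] {x y : L}
    (hxy : minpoly K x = minpoly K y) {c : K} (hx : IsIntegral R (c • x)) :
    IsIntegral R (c • y) := by
  obtain ⟨q, hq, hqx⟩ := hx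
  refine ⟨q, hq, ?_⟩
  have key (z : L) : eval₂ (algebraMap R L) (c • z) q
      = aeval z ((q.map (algebraMap R K)).comp (C c * X)) := by
    rw [aeval_comp, aeval_map_algebraMap, aeval_def]
    simp [Algebra.smul_def]
  rw [key] at hqx ⊢
  obtain ⟨r, hr⟩ := minpoly.dvd K x hqx
  rw [hr, hxy, map_mul, minpoly.aeval, zero_mul]

/-- The inverse of a nonzero element of `p𝒪` has a different minimal polynomial. -/
theorem Padic.minpoly_ne_minpoly_inv {p : ℕ} [Fact p.Prime] {L : Type*} [Field L]
    [Algebra ℚ_[p] L] [Algebra ℤ_[p] L] [IsScalarTower ℤ_[p] ℚ_[p] L] {x a : L} (hx : x ≠ 0)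
    (ha : IsIntegral ℤ_[p] a) (hxa : x = (p : L) * a) :
    minpoly ℚ_[p] x ≠ minpoly ℚ_[p] x⁻¹ := by
  intro heq
  have hp : (p : ℚ_[p]) ≠ 0 := Nat.cast_ne_zero.mpr (Fact.out : p.Prime).ne_zero
  have hpx : (p : ℚ_[p])⁻¹ • x = a := by
    rw [inv_smul_eq_iff₀ hp, hxa, Algebra.smul_def, map_natCast]
  have h₁ : IsIntegral ℤ_[p] ((p : ℚ_[p])⁻¹ • x) := hpx ▸ ha
  have h₂ := h₁.mul (h₁.smul_of_minpoly_eq heq)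
  rw [smul_mul_smul_comm, mul_inv_cancel₀ hx, ← Algebra.algebraMap_eq_smul_one,
    isIntegral_algebraMap_iff (algebraMap ℚ_[p] L).injective,
    IsIntegrallyClosed.isIntegral_iff] at h₂
  obtain ⟨z, hz⟩ := h₂
  have hone : (1 : ℝ) < p := mod_cast (Fact.out : p.Prime).one_lt
  have hnorm : ‖(p : ℚ_[p])⁻¹ * (p : ℚ_[p])⁻¹‖ ≤ 1 := hz ▸ z.2
  rw [norm_mul, norm_inv, Padic.norm_p, inv_inv] at hnorm
  nlinarith


/-- Let `F₀/ℚ_p` be a finite extension of degree `g` with ring of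
integers `𝒪₀`, and let `u₁` be a nonzero element of `p·𝒪₀` generating `F₀` as a
`ℚ_p`-algebra. Then the minimal polynomials over `ℚ_p` of `u₁` and of `u₁⁻¹` are
relatively prime (in particular distinct), and the `ℚ_p`-subalgebra of `F₀ × F₀`
generated by `(u₁, u₁⁻¹)` equals all of `F₀ × F₀`. -/
theorem statement7
    (p : ℕ) [Fact p.Prime]
    (F₀ : Type*) [Field F₀] [Algebra ℚ_[p] F₀] [FiniteDimensional ℚ_[p] F₀]
    [Algebra ℤ_[p] F₀] [IsScalarTower ℤ_[p] ℚ_[p] F₀]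
    (g : ℕ) (hg : Module.finrank ℚ_[p] F₀ = g)
    (u₁ : F₀) (hu₁ : u₁ ≠ 0)
    (hmem : ∃ a ∈ integralClosure ℤ_[p] F₀, u₁ = (p : F₀) * a)
    (hadj : Algebra.adjoin ℚ_[p] {u₁} = ⊤) :
    IsCoprime (minpoly ℚ_[p] u₁) (minpoly ℚ_[p] u₁⁻¹) ∧
    minpoly ℚ_[p] u₁ ≠ minpoly ℚ_[p] u₁⁻¹ ∧
    Algebra.adjoin ℚ_[p] {((u₁, u₁⁻¹) : F₀ × F₀)} = ⊤ := by
  obtain ⟨a, ha, hua⟩ := hmem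
  have hne := Padic.minpoly_ne_minpoly_inv hu₁ ha hua
  have hint (x : F₀) : IsIntegral ℚ_[p] x := Algebra.IsIntegral.isIntegral x
  have hcop : IsCoprime (minpoly ℚ_[p] u₁) (minpoly ℚ_[p] u₁⁻¹) := by
    rw [(minpoly.irreducible (hint u₁)).coprime_iff_not_dvd]
    intro hdvd
    exact hne (Polynomial.eq_of_monic_of_associated (minpoly.monic (hint _))
      (minpoly.monic (hint _)) ((minpoly.irreducible (hint _)).associated_of_dvd
        (minpoly.irreducible (hint _)) hdvd))
  exact ⟨hcop, hne, Algebra.adjoin_prodMk_eq_top_of_isCoprime_minpoly hcop hadj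
    (Algebra.adjoin_inv_eq_top hadj)⟩
end

section
/- Let $p$ be a prime, $C$ a commutative semisimple $\mathbb{Q}_p$-algebra of finite dimension $d \geq 1$, and $R$ an order in $C$. Regard $C$ as a $d$-dimensional $\mathbb{Q}_p$-vector space $V$ containing the $\mathbb{Z}_p$-lattice $T = R$, and let each $c \in C$ act on $V$ by multiplication, giving an embedding $C \hookrightarrow \mathrm{End}_{\mathbb{Q}_p}(V)$. Then there exists $\mathbf{u} \in C^\times$ such that: (1) the characteristic polynomial of multiplication by $\mathbf{u}$ on $V$ is squarefree; (2) the $\mathbb{Q}_p$-subalgebra of $C$ generated by $\mathbf{u}$ is $C$; and (3) the centralizer of $\mathbf{u}$ in $\mathrm{End}_{\mathbb{Z}_p}(T) = \{f \in \mathrm{End}_{\mathbb{Q}_p}(V) : f(T) \subseteq T\}$, namely $\{f \in \mathrm{End}_{\mathbb{Q}_p}(V) : f(T)\subseteq T \text{ and } f\circ\mathbf{u} = \mathbf{u}\circ f\}$, equals the image of $R$ acting by multiplication. -/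
open Polynomial Module

/-- A finite reduced algebra over a perfect field has at least as many points in an algebraically
closed field as its dimension. -/
theorem exists_injective_algHom_of_isReduced (K A L : Type*) [Field K] [PerfectField K]
    [CommRing A] [IsReduced A] [Algebra K A] [FiniteDimensional K A]
    [Field L] [IsAlgClosed L] [Algebra K L] :
    ∃ φ : Fin (finrank K A) → (A →ₐ[K] L), Function.Injective φ := by
  have : IsArtinianRing A := isArtinian_of_tower K inferInstance
  let _ (I : MaximalSpectrum A) : Field (A ⧸ I.asIdeal) := Ideal.Quotient.field I.asIdeal
  let _ := Fintype.ofFinite (MaximalSpectrum A)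
  let φ : (Σ I : MaximalSpectrum A, (A ⧸ I.asIdeal →ₐ[K] L)) → (A →ₐ[K] L) :=
    fun j => j.2.comp (Ideal.Quotient.mkₐ K j.1.asIdeal)
  have hker (j) : RingHom.ker (φ j) = j.1.asIdeal := by
    ext x
    simp [φ, RingHom.mem_ker, Ideal.Quotient.eq_zero_iff_mem]
  have hφ : Function.Injective φ := by
    intro j k h
    have hI : j.1 = k.1 := MaximalSpectrum.ext (by rw [← hker j, ← hker k, h])
    obtain ⟨I, f⟩ := j
    obtain ⟨J, g⟩ := k
    obtain rfl : I = J := hI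
    congr 1
    exact Ideal.Quotient.algHom_ext K h
  have hcard : Fintype.card (Σ I : MaximalSpectrum A, (A ⧸ I.asIdeal →ₐ[K] L)) =
      finrank K A := by
    rw [Fintype.card_sigma,
      ((IsArtinianRing.equivPi A).restrictScalars K).toLinearEquiv.finrank_eq,
      Module.finrank_pi_fintype]
    exact Finset.sum_congr rfl fun I _ => AlgHom.card K (A ⧸ I.asIdeal) L
  exact ⟨φ ∘ (Fintype.equivFinOfCardEq hcard).symm, hφ.comp (Equiv.injective _)⟩

/-- A finite reduced algebra over an infinite perfect field contains a unit whose minimal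
polynomial has degree the dimension of the algebra. -/
theorem exists_unit_natDegree_minpoly_eq_finrank (K A : Type*) [Field K] [PerfectField K]
    [Infinite K] [CommRing A] [IsReduced A] [Algebra K A] [FiniteDimensional K A] :
    ∃ u : Aˣ, finrank K A ≤ (minpoly K (u : A)).natDegree := by
  classical
  have : IsArtinianRing A := isArtinian_of_tower K inferInstance
  obtain ⟨φ, hφ⟩ := exists_injective_algHom_of_isReduced K A (AlgebraicClosure K)
  let P : MaximalSpectrum A ⊕ {ij : Fin (finrank K A) × Fin (finrank K A) // ij.1 ≠ ij.2} →
      Subspace K A := Sum.elim (fun I => I.asIdeal.restrictScalars K)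
    (fun ij => LinearMap.ker ((φ ij.1.1).toLinearMap - (φ ij.1.2).toLinearMap))
  have hP : ∀ i, P i ≠ ⊤ := by
    rintro (I | ⟨⟨i, j⟩, hij⟩) h
    · have h1 : (1 : A) ∈ P (.inl I) := h ▸ Submodule.mem_top
      exact (Ideal.ne_top_iff_one _).1 I.isMaximal.ne_top h1
    · refine hij (hφ (AlgHom.toLinearMap_injective ?_))
      exact sub_eq_zero.1 (LinearMap.ker_eq_top.1 h)
  obtain ⟨u, hu⟩ : ∃ u, ∀ i, u ∉ P i := by
    by_contra! h
    obtain ⟨i, hi⟩ := Subspace.exists_eq_top_of_iUnion_eq_univ (p := P)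
      (Set.eq_univ_of_forall fun u => Set.mem_iUnion.2 (h u))
    exact hP i hi
  have hunit : IsUnit u := by
    by_contra hn
    obtain ⟨I, hI, huI⟩ := exists_max_ideal_of_mem_nonunits hn
    exact hu (.inl ⟨I, hI⟩) huI
  have hinj : Function.Injective fun i => φ i u := by
    intro i j h
    by_contra hij
    exact hu (.inr ⟨(i, j), hij⟩) (by simpa [P, sub_eq_zero] using h)
  refine ⟨hunit.unit, ?_⟩
  rw [IsUnit.unit_spec]
  have hne := minpoly.ne_zero (Algebra.IsIntegral.isIntegral (R := K) u)
  have hsub : Finset.univ.image (fun i => φ i u) ⊆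
      ((minpoly K u).aroots (AlgebraicClosure K)).toFinset := by
    intro x hx
    obtain ⟨i, -, rfl⟩ := Finset.mem_image.1 hx
    rw [Multiset.mem_toFinset, mem_aroots]
    exact ⟨hne, by rw [aeval_algHom_apply, minpoly.aeval, map_zero]⟩
  calc finrank K A = (Finset.univ.image (fun i => φ i u)).card := by
        rw [Finset.card_image_of_injective _ hinj, Finset.card_univ, Fintype.card_fin]
    _ ≤ _ := Finset.card_le_card hsub
    _ ≤ _ := Multiset.toFinset_card_le _
    _ ≤ _ := card_roots' _
    _ = _ := natDegree_map _

theorem squarefree_minpoly_of_isReduced {K A : Type*} [Field K] [CommRing A] [IsReduced A]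
    [Algebra K A] {x : A} (hx : IsIntegral K x) : Squarefree (minpoly K x) := by
  rintro a ⟨b, hb⟩
  have hne := minpoly.ne_zero hx
  have hab : aeval x (a * b) = 0 := by
    refine IsReduced.eq_zero _ ⟨2, ?_⟩
    rw [← map_pow, show (a * b) ^ 2 = a * a * b * b by ring, ← hb, map_mul, minpoly.aeval,
      zero_mul]
  obtain ⟨c, hc⟩ := minpoly.dvd K x hab
  have hab0 : a * b ≠ 0 := by
    rintro h
    exact hne (by rw [hb, mul_assoc, h, mul_zero])
  refine IsUnit.of_mul_eq_one c (mul_left_cancel₀ hab0 ?_)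
  calc a * b * (a * c) = a * a * b * c := by ring
    _ = a * b * 1 := by rw [← hb, ← hc, mul_one]

theorem charpoly_mulLeft_eq_minpoly {K A : Type*} [Field K] [CommRing A] [Algebra K A]
    [FiniteDimensional K A] {x : A} (hx : finrank K A ≤ (minpoly K x).natDegree) :
    (LinearMap.mulLeft K x).charpoly = minpoly K x := by
  have hmin : minpoly K (LinearMap.mulLeft K x) = minpoly K x :=
    minpoly.algHom_eq (Algebra.lmul K A) Algebra.lmul_injective x
  refine (eq_of_monic_of_dvd_of_natDegree_le
    (minpoly.monic (Algebra.IsIntegral.isIntegral x)) (LinearMap.charpoly_monic _) ?_ ?_)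
  · rw [← hmin]
    exact LinearMap.minpoly_dvd_charpoly _
  · rwa [LinearMap.charpoly_natDegree]

theorem adjoin_singleton_eq_top_of_finrank_le {K A : Type*} [Field K] [CommRing A] [Algebra K A]
    [FiniteDimensional K A] {x : A} (hx : finrank K A ≤ (minpoly K x).natDegree) :
    Algebra.adjoin K {x} = ⊤ := by
  have hspan := (linearIndependent_pow (K := K) x).span_eq_top_of_card_eq_finrank'
    (le_antisymm (linearIndependent_pow (K := K) x).fintype_card_le_finrank
      (by rwa [Fintype.card_fin]))
  rw [← Algebra.toSubmodule_eq_top, eq_top_iff, ← hspan, Submodule.span_le]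
  rintro _ ⟨i, rfl⟩
  exact pow_mem (Algebra.self_mem_adjoin_singleton K x) _

theorem eq_mulLeft_of_commute_mulLeft {K A : Type*} [CommSemiring K] [CommSemiring A]
    [Algebra K A] {x : A} (hx : Algebra.adjoin K {x} = ⊤) {f : Module.End K A}
    (hf : Commute f (LinearMap.mulLeft K x)) : f = LinearMap.mulLeft K (f 1) := by
  have hle : Algebra.adjoin K {x} ≤
      (Subalgebra.centralizer K {f}).comap (Algebra.lmul K A) := by
    rw [Algebra.adjoin_le_iff, Set.singleton_subset_iff]
    rintro g rfl
    exact hf.eq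
  ext y
  have hy : y ∈ Algebra.adjoin K {x} := hx ▸ Algebra.mem_top
  have h := LinearMap.congr_fun (Subalgebra.mem_centralizer_iff K |>.1 (hle hy) f rfl) 1
  simpa [mul_comm] using h


/-- Let `C` be a commutative semisimple (equivalently, reduced)
`ℚ_p`-algebra of finite dimension `d ≥ 1` and `R` an order in `C` (a `ℤ_p`-subalgebra
that is a free `ℤ_p`-module of rank `d`). Regard `C` as a `d`-dimensional `ℚ_p`-vector
space containing the lattice `R`, each `c ∈ C` acting by multiplication. Then there is
`u ∈ C^×` such that: (1) the characteristic polynomial of multiplication by `u` is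
squarefree; (2) the `ℚ_p`-subalgebra generated by `u` is `C`; and (3) the centralizer of
`u` in the ring of endomorphisms preserving `R` is exactly the image of `R` acting by
multiplication. -/
theorem statement10
    (p : ℕ) [Fact p.Prime]
    (C : Type*) [CommRing C] [Algebra ℚ_[p] C] [IsReduced C] [FiniteDimensional ℚ_[p] C]
    [Algebra ℤ_[p] C] [IsScalarTower ℤ_[p] ℚ_[p] C]
    (d : ℕ) (hd : 1 ≤ d) (hdim : Module.finrank ℚ_[p] C = d)
    (R : Subalgebra ℤ_[p] C) [Module.Free ℤ_[p] ↥R]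
    (hrank : Module.finrank ℤ_[p] ↥R = d) :
    ∃ u : Cˣ,
      Squarefree (LinearMap.charpoly (LinearMap.mulLeft ℚ_[p] (u : C))) ∧
      Algebra.adjoin ℚ_[p] {(u : C)} = ⊤ ∧
      {f : Module.End ℚ_[p] C | (∀ t ∈ R, f t ∈ R) ∧
          Commute f (LinearMap.mulLeft ℚ_[p] (u : C))} =
        {f : Module.End ℚ_[p] C | ∃ r ∈ R, f = LinearMap.mulLeft ℚ_[p] r} := by
  obtain ⟨u, hu⟩ := exists_unit_natDegree_minpoly_eq_finrank ℚ_[p] C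
  have htop := adjoin_singleton_eq_top_of_finrank_le hu
  refine ⟨u, ?_, htop, ?_⟩
  · rw [charpoly_mulLeft_eq_minpoly hu]
    exact squarefree_minpoly_of_isReduced (Algebra.IsIntegral.isIntegral _)
  · ext f
    constructor
    · rintro ⟨hfR, hf⟩
      exact ⟨f 1, hfR 1 R.one_mem, eq_mulLeft_of_commute_mulLeft htop hf⟩
    · rintro ⟨r, hr, rfl⟩
      refine ⟨fun t ht => R.mul_mem hr ht, ?_⟩
      ext y
      simp [mul_left_comm]
end

section
/- Let $P$ be a nonempty finite set of primes, and for each $\ell \in P$ let $d_\ell \geq 1$ be an integer and $G_\ell$ a compact open subgroup of $GL_{d_\ell}(\mathbb{Q}_\ell)$ (with its $\ell$-adic topology). Let $H$ be a closed subgroup of the product group $\prod_{\ell \in P} G_\ell$ such that for every $\ell \in P$ the projection $H \to G_\ell$ is surjective. Then $H$ is an open subgroup of finite index in $\prod_{\ell \in P} G_\ell$. -/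
open scoped Topology
open Filter

namespace Matrix

variable {p : ℕ} [Fact p.Prime] {n : Type*} [Fintype n]

/-- Bounds on the entries of `p`-adic matrices are submultiplicative. -/
theorem padic_norm_mul_apply_le {A B : Matrix n n ℚ_[p]} {a b : ℝ} (ha : 0 ≤ a) (hb : 0 ≤ b)
    (hA : ∀ i j, ‖A i j‖ ≤ a) (hB : ∀ i j, ‖B i j‖ ≤ b) (i j : n) : ‖(A * B) i j‖ ≤ a * b := by
  rw [mul_apply]
  refine IsUltrametricDist.norm_sum_le_of_forall_le_of_nonneg (mul_nonneg ha hb) fun k _ => ?_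
  rw [norm_mul]
  exact mul_le_mul (hA i k) (hB k j) (norm_nonneg _) ha

variable [DecidableEq n]

/-- A bound `r < 1` on the entries of `g - 1` is inherited by `g⁻¹ - 1`. -/
theorem padic_norm_inv_sub_one_apply_le {g : GL n ℚ_[p]} {r : ℝ} (hr0 : 0 ≤ r) (hr1 : r < 1)
    (hg : ∀ i j, ‖(g.val - 1) i j‖ ≤ r) (i j : n) : ‖(g⁻¹.val - 1) i j‖ ≤ r := by
  have : Nonempty (n × n) := ⟨(i, j)⟩
  obtain ⟨x, hx⟩ := Finite.exists_max fun x : n × n => ‖(g⁻¹.val - 1) x.1 x.2‖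
  have hmul := padic_norm_mul_apply_le (norm_nonneg _) hr0 (fun a b => hx (a, b)) hg x.1 x.2
  have heq : g⁻¹.val - 1 = -((g⁻¹.val - 1) * (g.val - 1) + (g.val - 1)) := by
    have : g⁻¹.val * g.val = 1 := by rw [← Units.val_mul, inv_mul_cancel, Units.val_one]
    rw [sub_mul, mul_sub, this]
    simp
  have hmax : ‖(g⁻¹.val - 1) x.1 x.2‖ ≤ max (‖(g⁻¹.val - 1) x.1 x.2‖ * r) r := by
    conv_lhs => rw [heq, neg_apply, norm_neg, add_apply]
    exact (IsUltrametricDist.norm_add_le_max _ _).trans (max_le_max hmul (hg _ _))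
  refine (hx (i, j)).trans ?_
  rcases le_max_iff.1 hmax with h | h
  · nlinarith [norm_nonneg ((g⁻¹.val - 1) x.1 x.2)]
  · exact h

variable (p n) in
/-- The principal congruence subgroup of `GL n ℚ_[p]` of matrices that are integral and congruent
to `1` modulo `p ^ (k + 1)`. -/
def padicCongruenceSubgroup (k : ℕ) : Subgroup (GL n ℚ_[p]) where
  carrier := {g | ∀ i j, ‖(g.val - 1) i j‖ ≤ (p : ℝ)⁻¹ ^ (k + 1)}
  one_mem' i j := by simp
  mul_mem' {g h} hg hh i j := by
    have hp : (p : ℝ)⁻¹ ^ (k + 1) ≤ 1 := pow_le_one₀ (by positivity) (Nat.cast_inv_le_one p)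
    have heq : (g * h).val - 1 = (g.val - 1) * (h.val - 1) + ((g.val - 1) + (h.val - 1)) := by
      rw [Units.val_mul]; noncomm_ring
    rw [heq]
    refine (IsUltrametricDist.norm_add_le_max _ _).trans (max_le ?_ ?_)
    · refine (padic_norm_mul_apply_le (by positivity) (by positivity) hg hh i j).trans ?_
      exact mul_le_of_le_one_left (by positivity) hp
    · exact (IsUltrametricDist.norm_add_le_max _ _).trans (max_le (hg i j) (hh i j))
  inv_mem' {g} hg := by
    refine padic_norm_inv_sub_one_apply_le (by positivity) ?_ hg
    exact pow_lt_one₀ (by positivity)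
      (inv_lt_one_of_one_lt₀ (by exact_mod_cast (Fact.out : p.Prime).one_lt)) (by lia)

theorem padicCongruenceSubgroup_antitone : Antitone (padicCongruenceSubgroup p n) :=
  fun _ _ hkl _ hg i j => (hg i j).trans <|
    pow_le_pow_of_le_one (by positivity) (Nat.cast_inv_le_one p) (by lia)

theorem isOpen_padicCongruenceSubgroup (k : ℕ) :
    IsOpen (padicCongruenceSubgroup p n k : Set (GL n ℚ_[p])) := by
  refine Subgroup.isOpen_of_mem_nhds (g := 1) _ ?_
  have hp : (0 : ℝ) < p := by exact_mod_cast (Fact.out : p.Prime).pos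
  have hcont (i j : n) : Continuous fun g : GL n ℚ_[p] => ‖(g.val - 1) i j‖ :=
    ((Units.continuous_val.sub continuous_const).matrix_elem i j).norm
  have hev (i j : n) : ∀ᶠ g : GL n ℚ_[p] in 𝓝 1, ‖(g.val - 1) i j‖ ≤ (p : ℝ)⁻¹ ^ (k + 1) :=
    (hcont i j).continuousAt.eventually_le_const (by simp; positivity)
  exact eventually_all.2 fun i => eventually_all.2 fun j => hev i j

theorem pow_mem_padicCongruenceSubgroup_succ {k : ℕ} {g : GL n ℚ_[p]}
    (hg : g ∈ padicCongruenceSubgroup p n k) : g ^ p ∈ padicCongruenceSubgroup p n (k + 1) := by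
  have hsum (i j : n) : ‖(∑ a ∈ Finset.range p, g.val ^ a) i j‖ ≤ (p : ℝ)⁻¹ := by
    have heq : ∑ a ∈ Finset.range p, g.val ^ a
        = ∑ a ∈ Finset.range p, (g.val ^ a - 1) + (p : Matrix n n ℚ_[p]) := by
      simp
    rw [heq]
    refine (IsUltrametricDist.norm_add_le_max _ _).trans (max_le ?_ ?_)
    · rw [sum_apply]
      refine IsUltrametricDist.norm_sum_le_of_forall_le_of_nonneg (by positivity) fun a _ => ?_
      have := padicCongruenceSubgroup_antitone (Nat.zero_le k) (pow_mem hg a) i j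
      simpa using this
    · rw [natCast_apply]
      split_ifs <;> simp
  intro i j
  rw [Units.val_pow_eq_pow_val, ← mul_geom_sum, pow_succ]
  exact padic_norm_mul_apply_le (by positivity) (by positivity) hg hsum i j

theorem pow_prime_pow_mem_padicCongruenceSubgroup {g : GL n ℚ_[p]}
    (hg : g ∈ padicCongruenceSubgroup p n 0) (k : ℕ) :
    g ^ p ^ k ∈ padicCongruenceSubgroup p n k := by
  induction k with
  | zero => simpa using hg
  | succ k ih => rw [pow_succ, pow_mul]; exact pow_mem_padicCongruenceSubgroup_succ ih

theorem tendsto_one_of_mem_padicCongruenceSubgroup {u : ℕ → GL n ℚ_[p]}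
    (hu : ∀ k, u k ∈ padicCongruenceSubgroup p n k) : Tendsto u atTop (𝓝 1) := by
  have key {v : ℕ → GL n ℚ_[p]} (hv : ∀ k, v k ∈ padicCongruenceSubgroup p n k) :
      Tendsto (fun k => (v k).val) atTop (𝓝 1) := by
    refine tendsto_pi_nhds.2 fun i => tendsto_pi_nhds.2 fun j => ?_
    rw [tendsto_iff_norm_sub_tendsto_zero]
    refine squeeze_zero (fun _ => norm_nonneg _) (fun k => hv k i j) ?_
    exact (tendsto_pow_atTop_nhds_zero_of_lt_one (by positivity)
      (inv_lt_one_of_one_lt₀ (by exact_mod_cast (Fact.out : p.Prime).one_lt))).comp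
      (tendsto_add_atTop_nat 1)
  rw [Units.isEmbedding_embedProduct.tendsto_nhds_iff]
  exact (key hu).prodMk_nhds
    (MulOpposite.continuous_op.continuousAt.tendsto.comp (key fun k => inv_mem (hu k)))

/-- Powers of an element congruent to `1` modulo `p` depend `p`-adically continuously on the
exponent. -/
theorem tendsto_pow_of_modEq {g : GL n ℚ_[p]} (hg : g ∈ padicCongruenceSubgroup p n 0)
    {e : ℕ → ℕ} {a : ℕ} (he : ∀ k, a ≡ e k [MOD p ^ k]) :
    Tendsto (fun k => g ^ e k) atTop (𝓝 (g ^ a)) := by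
  have h := tendsto_one_of_mem_padicCongruenceSubgroup (u := fun k => g ^ e k * (g ^ a)⁻¹)
    fun k => by
      obtain ⟨m, hm⟩ := Nat.modEq_iff_dvd.1 (he k)
      have heq : g ^ e k * (g ^ a)⁻¹ = (g ^ p ^ k) ^ m := by
        rw [← zpow_natCast g (e k), ← zpow_natCast g a, ← zpow_natCast g (p ^ k),
          ← _root_.zpow_sub, hm, _root_.zpow_mul]
      rw [heq]
      exact zpow_mem (pow_prime_pow_mem_padicCongruenceSubgroup hg k) m
  simpa using h.mul_const (g ^ a)

end Matrix

/-- A homomorphism that is surjective on `H` maps the trace on `H` of a finite index subgroup to a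
finite index subgroup. -/
theorem Subgroup.finiteIndex_map_inf {A B : Type*} [Group A] [Group B] (f : A →* B)
    (H U : Subgroup A) [U.FiniteIndex] (hf : Function.Surjective fun h : H => f h) :
    ((H ⊓ U).map f).FiniteIndex := by
  have heq : (H ⊓ U).map f = (U.subgroupOf H).map (f.comp H.subtype) := by
    rw [← Subgroup.map_map, Subgroup.subgroupOf_map_subtype, inf_comm]
  rw [heq]
  exact ⟨ne_zero_of_dvd_ne_zero Subgroup.FiniteIndex.index_ne_zero
    (Subgroup.index_map_dvd (f := f.comp H.subtype) _ hf)⟩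

/-- Exponents that approximate the `i`-th idempotent of `∏ j, ℤ_[ℓ j]`. -/
theorem exists_modEq_single {ι : Type*} [Fintype ι] [DecidableEq ι] {ℓ : ι → ℕ}
    (hℓ : ∀ i, (ℓ i).Prime) (hinj : Function.Injective ℓ) (i : ι) :
    ∃ e : ℕ → ℕ, ∀ j k, (Pi.single i 1 : ι → ℕ) j ≡ e k [MOD ℓ j ^ k] := by
  have hpair (k : ℕ) : Set.Pairwise ((Finset.univ : Finset ι) : Set ι)
      (Function.onFun Nat.Coprime fun j => ℓ j ^ k) := fun a _ b _ hab =>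
    Nat.Coprime.pow _ _ ((Nat.coprime_primes (hℓ a) (hℓ b)).2 (hinj.ne hab))
  let e (k : ℕ) := Nat.chineseRemainderOfFinset (Pi.single i 1 : ι → ℕ) (fun j => ℓ j ^ k)
    Finset.univ (fun j _ => pow_ne_zero _ (hℓ j).ne_zero) (hpair k)
  exact ⟨fun k => e k, fun j k => ((e k).2 j (Finset.mem_univ j)).symm⟩

/-- Let `P` be a nonempty finite set of pairwise distinct primes and for
each `ℓ ∈ P` let `G_ℓ` be a compact open subgroup of `GL_{d_ℓ}(ℚ_ℓ)`. If `H` is a closed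
subgroup of `∏_{ℓ ∈ P} G_ℓ` whose projection to each factor is surjective, then `H` is an
open subgroup of finite index in `∏_{ℓ ∈ P} G_ℓ`. -/
theorem statement14
    (ι : Type*) [Fintype ι] [Nonempty ι]
    (ℓ : ι → ℕ) [∀ i, Fact (ℓ i).Prime] (hinj : Function.Injective ℓ)
    (d : ι → ℕ) (hd : ∀ i, 1 ≤ d i)
    (G : ∀ i, Subgroup (GL (Fin (d i)) ℚ_[ℓ i]))
    (hGopen : ∀ i, IsOpen ((G i : Set (GL (Fin (d i)) ℚ_[ℓ i]))))
    (hGcpt : ∀ i, IsCompact ((G i : Set (GL (Fin (d i)) ℚ_[ℓ i]))))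
    (H : Subgroup (∀ i, ↥(G i)))
    (hclosed : IsClosed (H : Set (∀ i, ↥(G i))))
    (hsurj : ∀ i : ι, Function.Surjective fun h : H => (h : ∀ j, ↥(G j)) i) :
    IsOpen (H : Set (∀ i, ↥(G i))) ∧ H.FiniteIndex := by
  classical
  have (i : ι) : CompactSpace (G i) := isCompact_iff_compactSpace.1 (hGcpt i)
  let U (i : ι) : Subgroup (G i) :=
    (Matrix.padicCongruenceSubgroup (ℓ i) (Fin (d i)) 0).subgroupOf (G i)
  have hU (i : ι) : IsOpen (U i : Set (G i)) :=
    (Matrix.isOpen_padicCongruenceSubgroup 0).preimage continuous_subtype_val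
  have hUpi : IsOpen (Subgroup.pi Set.univ U : Set (∀ i, G i)) :=
    isOpen_set_pi Set.finite_univ fun i _ => hU i
  have : Finite ((∀ i, G i) ⧸ Subgroup.pi Set.univ U) := Subgroup.quotient_finite_of_isOpen _ hUpi
  have : (Subgroup.pi Set.univ U).FiniteIndex := Subgroup.finiteIndex_of_finite_quotient
  let V (i : ι) : Subgroup (G i) := (H ⊓ Subgroup.pi Set.univ U).map (Pi.evalMonoidHom _ i)
  have hV (i : ι) : IsOpen (V i : Set (G i)) := by
    have : (V i).FiniteIndex := Subgroup.finiteIndex_map_inf _ H _ (hsurj i)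
    refine Subgroup.isOpen_of_isClosed_of_finiteIndex _ ?_
    have hcpt : IsCompact ((H ⊓ Subgroup.pi Set.univ U : Subgroup _) : Set (∀ i, G i)) :=
      (hclosed.inter (Subgroup.isClosed_of_isOpen _ hUpi)).isCompact
    exact (hcpt.image (continuous_apply i)).isClosed
  have hVH : Subgroup.pi Set.univ V ≤ H := by
    refine Subgroup.pi_le_iff.2 fun i => ?_
    rintro _ ⟨_, ⟨h, ⟨hH, hhU⟩, rfl⟩, rfl⟩
    obtain ⟨e, he⟩ := exists_modEq_single (fun i => (Fact.out : (ℓ i).Prime)) hinj i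
    have hlim : Tendsto (fun k => h ^ e k) atTop (𝓝 (Pi.mulSingle i (h i))) := by
      refine tendsto_pi_nhds.2 fun j => tendsto_subtype_rng.2 ?_
      have hj := Matrix.tendsto_pow_of_modEq (hhU j trivial) (he j)
      obtain rfl | hij := eq_or_ne j i
      · simpa using hj
      · simpa [hij] using hj
    exact hclosed.mem_of_tendsto hlim (.of_forall fun k => pow_mem hH _)
  have hopen : IsOpen (H : Set (∀ i, G i)) :=
    Subgroup.isOpen_mono hVH (isOpen_set_pi Set.finite_univ fun i _ => hV i)
  have : Finite ((∀ i, G i) ⧸ H) := Subgroup.quotient_finite_of_isOpen _ hopen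
  exact ⟨hopen, Subgroup.finiteIndex_of_finite_quotient⟩
end
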